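/- Let E = ℂ⁵ and let L = {ψ_δ : δ ∈ Δ₊} ⊆ Hom(E ⊕ E*, Δ₋), where ψ_δ(e,f) = e ∧ δ + f ⌟ δ. Then: (1) the map δ ↦ ψ_δ is injective, so L is a 16-dimensional linear subspace; (2) the maximal rank of elements of L equals 9; (3) L is rank-critical: every linear subspace of Hom(E ⊕ E*, Δ₋) strictly containing L contains an element of rank strictly greater than 9. -/

import Mathlib

open Module LinearMap ExteriorAlgebra

/-- The half-spin representation `Δ₊ = ⋀⁰E ⊕ ⋀²E ⊕ ⋀⁴E`, inside the exterior algebra. -/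
noncomputable def deltaPlus (E : Type*) [AddCommGroup E] [Module ℂ E] :
    Submodule ℂ (ExteriorAlgebra ℂ E) := ⋀[ℂ]^0 E ⊔ ⋀[ℂ]^2 E ⊔ ⋀[ℂ]^4 E

/-- The half-spin representation `Δ₋ = ⋀¹E ⊕ ⋀³E ⊕ ⋀⁵E`, inside the exterior algebra. -/
noncomputable def deltaMinus (E : Type*) [AddCommGroup E] [Module ℂ E] :
    Submodule ℂ (ExteriorAlgebra ℂ E) := ⋀[ℂ]^1 E ⊔ ⋀[ℂ]^3 E ⊔ ⋀[ℂ]^5 E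

variable {E : Type*} [AddCommGroup E] [Module ℂ E]

/-- The space `L = {ψ_δ : δ ∈ Δ₊} ⊆ Hom(E ⊕ E*, Δ₋)`, where
`ψ_δ(e,f) = e ∧ δ + f ⌟ δ`. -/
noncomputable def psiSet (E : Type*) [AddCommGroup E] [Module ℂ E] :
    Set ((E × Module.Dual ℂ E) →ₗ[ℂ] deltaMinus E) :=
  {g | ∃ δ ∈ deltaPlus E, ∀ p : E × Module.Dual ℂ E,
    (g p : ExteriorAlgebra ℂ E) =
      ι ℂ p.1 * δ + CliffordAlgebra.contractLeft (Q := (0 : QuadraticForm ℂ E)) p.2 δ}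

theorem LinearMap.eq_apply_smul_of_forall_apply_eq_zero {K V W : Type*} [Field K]
    [AddCommGroup V] [Module K V] [Nontrivial V] [AddCommGroup W] [Module K W]
    (Φ : V →ₗ[K] Module.Dual K V →ₗ[K] W) (hΦ : ∀ e f, f e = 0 → Φ e f = 0) :
    ∃ w : W, ∀ e f, Φ e f = f e • w := by
  obtain ⟨e₀, he₀⟩ := exists_ne (0 : V)
  obtain ⟨f₀, hf₀⟩ := Module.Projective.exists_dual_eq_one K he₀
  have h1 (f : Module.Dual K V) : Φ e₀ f = f e₀ • Φ e₀ f₀ := by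
    have := hΦ e₀ (f - f e₀ • f₀) (by simp [hf₀])
    rwa [map_sub, map_smul, sub_eq_zero] at this
  have h2 (e : V) (f : Module.Dual K V) (hf : f e₀ ≠ 0) : Φ e f = f e • Φ e₀ f₀ := by
    have := hΦ (e - (f e / f e₀) • e₀) f (by simp [hf])
    rwa [map_sub, map_smul, LinearMap.sub_apply, LinearMap.smul_apply, h1 f, smul_smul,
      div_mul_cancel₀ _ hf, sub_eq_zero] at this
  refine ⟨Φ e₀ f₀, fun e f ↦ ?_⟩
  by_cases hf : f e₀ = 0
  · have h3 := h2 e (f + f₀) (by simp [hf, hf₀])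
    rw [map_add, h2 e f₀ (by simp [hf₀]), LinearMap.add_apply, add_smul] at h3
    exact add_right_cancel h3
  · exact h2 e f hf

section RankOfPencils

variable {K V W : Type*} [Field K] [Infinite K] [AddCommGroup V] [Module K V]
  [FiniteDimensional K V] [AddCommGroup W] [Module K W]

theorem LinearMap.exists_ne_zero_injective_add_smul {A : V →ₗ[K] W} (hA : Function.Injective A)
    (N : V →ₗ[K] W) : ∃ t : K, t ≠ 0 ∧ Function.Injective (A + t • N) := by
  obtain ⟨P, hP⟩ := A.exists_leftInverse_of_injective (LinearMap.ker_eq_bot.2 hA)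
  have hfin := (Module.End.finite_hasEigenvalue (P ∘ₗ N)).union (Set.finite_singleton (0 : K))
  obtain ⟨s, hs⟩ := hfin.exists_notMem
  simp only [Set.mem_union, Set.mem_ofPred_eq, Set.mem_singleton_iff, not_or] at hs
  refine ⟨-s⁻¹, by simpa using hs.2, (injective_iff_map_eq_zero _).2 fun x hx ↦ ?_⟩
  by_contra hx0
  refine hs.1 (Module.End.hasEigenvalue_of_hasEigenvector (x := x)
    ⟨Module.End.mem_eigenspace_iff.2 ?_, hx0⟩)
  have h1 : P (A x) = x := LinearMap.congr_fun hP x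
  have h2 := congrArg P hx
  simp only [LinearMap.add_apply, LinearMap.smul_apply, map_add, map_smul, h1, map_zero] at h2
  have h3 : s • (x + -s⁻¹ • P (N x)) = 0 := by rw [h2, smul_zero]
  rw [smul_add, smul_smul, mul_neg, mul_inv_cancel₀ hs.2, neg_one_smul, ← sub_eq_add_neg,
    sub_eq_zero] at h3
  exact h3.symm

theorem LinearMap.apply_mem_range_of_forall_not_injective {A B : V →ₗ[K] W} {v : V} (hv : v ≠ 0)
    (hA : LinearMap.ker A = K ∙ v) (hAB : ∀ t : K, ¬ Function.Injective (A + t • B)) :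
    B v ∈ LinearMap.range A := by
  by_contra hBv
  obtain ⟨φ, hφ⟩ := Module.Projective.exists_dual_eq_one K hv
  have hAv : A v = 0 := by
    rw [← LinearMap.mem_ker, hA]; exact Submodule.mem_span_singleton_self v
  have hM : Function.Injective (A + φ.smulRight (B v)) := by
    refine (injective_iff_map_eq_zero _).2 fun x hx ↦ ?_
    simp only [LinearMap.add_apply, LinearMap.smulRight_apply] at hx
    have hφx : φ x = 0 := by
      by_contra h
      refine hBv ⟨-(φ x)⁻¹ • x, ?_⟩
      rw [map_smul, eq_neg_of_add_eq_zero_left hx, smul_neg, neg_smul, neg_neg, smul_smul,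
        inv_mul_cancel₀ h, one_smul]
    rw [hφx, zero_smul, add_zero, ← LinearMap.mem_ker, hA, Submodule.mem_span_singleton] at hx
    obtain ⟨c, rfl⟩ := hx
    simp only [map_smul, hφ, smul_eq_mul, mul_one] at hφx
    rw [hφx, zero_smul]
  obtain ⟨t, ht, hinj⟩ := LinearMap.exists_ne_zero_injective_add_smul hM
    (B ∘ₗ (LinearMap.id - φ.smulRight v))
  refine hAB t ((injective_iff_map_eq_zero _).2 fun y hy ↦ ?_)
  have key : y - φ y • v + (t * φ y) • v = 0 := by
    refine (injective_iff_map_eq_zero _).1 hinj _ ?_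
    simp only [LinearMap.add_apply, LinearMap.smul_apply] at hy
    simp only [LinearMap.add_apply, LinearMap.smul_apply, LinearMap.smulRight_apply,
      LinearMap.comp_apply, LinearMap.sub_apply, LinearMap.id_apply, map_add, map_sub, map_smul,
      hAv, hφ]
    refine Eq.trans ?_ hy
    module
  have hφy : φ y = 0 := by
    have := congrArg φ key
    simp only [map_add, map_sub, map_smul, hφ, smul_eq_mul, map_zero] at this
    simpa [ht] using this
  simpa [hφy] using key

end RankOfPencils

theorem Module.Basis.exists_fin_of_pairing_eq_zero {K V : Type*} [Field K] [AddCommGroup V]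
    [Module K V] {n : ℕ} (hn : finrank K V = n + 2) {e : V} {f : Module.Dual K V}
    (hef : f e = 0) (he : e ≠ 0) (hf : f ≠ 0) :
    ∃ b : Basis (Fin (n + 2)) K V, b 0 = e ∧ b.coord 1 = f := by
  have : FiniteDimensional K V := FiniteDimensional.of_finrank_pos (by omega)
  obtain ⟨m, b, i, j, hij, rfl, rfl⟩ := exists_basis_of_pairing_eq_zero hef hf he
  have := FiniteDimensional.fintypeBasisIndex b
  have hcard : Fintype.card m = n + 2 := by rw [← hn, finrank_eq_card_basis b]
  let σ := Fintype.equivFinOfCardEq hcard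
  let τ := σ.trans (Equiv.swap (σ i) 0)
  have hτi : τ i = 0 := by simp [τ]
  have hτj : τ j ≠ 0 := by rw [← hτi]; exact fun h ↦ hij (τ.injective h).symm
  let ρ := τ.trans (Equiv.swap (τ j) 1)
  have hρi : ρ i = 0 := by
    simp only [ρ, Equiv.trans_apply, hτi]
    exact Equiv.swap_apply_of_ne_of_ne hτj.symm (by simp)
  have hρj : ρ j = 1 := by simp [ρ]
  refine ⟨b.reindex ρ, ?_, ?_⟩
  · rw [Basis.reindex_apply, ← hρi, Equiv.symm_apply_apply]
  · ext x
    rw [Basis.coord_apply, Basis.coord_apply, Basis.repr_reindex_apply, ← hρj,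
      Equiv.symm_apply_apply]

namespace ExteriorAlgebra

/-- Clifford multiplication of `E ⊕ E*` on the exterior algebra. -/
noncomputable def cliff : (E × Module.Dual ℂ E) →ₗ[ℂ] ExteriorAlgebra ℂ E →ₗ[ℂ]
    ExteriorAlgebra ℂ E :=
  LinearMap.coprod (LinearMap.mul ℂ (ExteriorAlgebra ℂ E) ∘ₗ ι ℂ)
    (CliffordAlgebra.contractLeft (Q := (0 : QuadraticForm ℂ E)))

local notation "C⟪" f "⟫" => CliffordAlgebra.contractLeft (Q := (0 : QuadraticForm ℂ _)) f

theorem cliff_apply (p : E × Module.Dual ℂ E) (x : ExteriorAlgebra ℂ E) :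
    cliff p x = ι ℂ p.1 * x + C⟪p.2⟫ x := rfl

theorem algebraMapInv_ι (e : E) : algebraMapInv (ι ℂ e) = (0 : ℂ) := by
  simp [algebraMapInv]

theorem ι_mul_ι_mul_self (e : E) (x : ExteriorAlgebra ℂ E) : ι ℂ e * (ι ℂ e * x) = 0 := by
  rw [← mul_assoc, ι_sq_zero, zero_mul]

theorem contractLeft_ι_mul (f : Module.Dual ℂ E) (e : E) (x : ExteriorAlgebra ℂ E) :
    C⟪f⟫ (ι ℂ e * x) = f e • x - ι ℂ e * C⟪f⟫ x :=
  CliffordAlgebra.contractLeft_ι_mul _ _ _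

theorem cliff_cliff (p q : E × Module.Dual ℂ E) (x : ExteriorAlgebra ℂ E) :
    cliff p (cliff q x) = (p.2 q.1 + q.2 p.1) • x - cliff q (cliff p x) := by
  have h : ι ℂ p.1 * (ι ℂ q.1 * x) = - (ι ℂ q.1 * (ι ℂ p.1 * x)) := by
    rw [← mul_assoc, ← mul_assoc, eq_neg_iff_add_eq_zero, ← add_mul, ι_add_mul_swap, zero_mul]
  simp only [cliff_apply, map_add, contractLeft_ι_mul, h,
    CliffordAlgebra.contractLeft_comm (d := p.2) (d' := q.2)]
  module

theorem ι_mul_mem {n : ℕ} (e : E) {x : ExteriorAlgebra ℂ E} (hx : x ∈ ⋀[ℂ]^n E) :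
    ι ℂ e * x ∈ ⋀[ℂ]^(n + 1) E := by
  rw [exteriorPower, pow_succ']
  exact Submodule.mul_mem_mul (LinearMap.mem_range_self _ e) hx

theorem contractLeft_eq_zero_of_mem_zero (f : Module.Dual ℂ E) {x : ExteriorAlgebra ℂ E}
    (hx : x ∈ ⋀[ℂ]^0 E) : C⟪f⟫ x = 0 := by
  rw [exteriorPower, pow_zero, Submodule.mem_one] at hx
  obtain ⟨a, rfl⟩ := hx
  exact CliffordAlgebra.contractLeft_algebraMap (Q := 0) _ _

theorem contractLeft_mem {n : ℕ} (f : Module.Dual ℂ E) {x : ExteriorAlgebra ℂ E}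
    (hx : x ∈ ⋀[ℂ]^(n + 1) E) : C⟪f⟫ x ∈ ⋀[ℂ]^n E := by
  induction n generalizing x with
  | zero =>
    rw [zero_add, exteriorPower, pow_one] at hx
    obtain ⟨e, rfl⟩ := hx
    rw [exteriorPower, pow_zero, Submodule.mem_one]
    exact ⟨f e, (CliffordAlgebra.contractLeft_ι (Q := 0) _ _).symm⟩
  | succ n ih =>
    rw [exteriorPower, pow_succ'] at hx
    induction hx using Submodule.mul_induction_on' with
    | mem_mul_mem a ha y hy =>
      obtain ⟨e, rfl⟩ := ha
      rw [contractLeft_ι_mul]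
      exact Submodule.sub_mem _ (Submodule.smul_mem _ _ hy) (ι_mul_mem e (ih hy))
    | add a _ b _ ha hb => rw [map_add]; exact Submodule.add_mem _ ha hb

theorem mem_two_induction {p : ExteriorAlgebra ℂ E → Prop}
    (mul : ∀ a b : E, p (ι ℂ a * ι ℂ b)) (add : ∀ x y, p x → p y → p (x + y))
    {x : ExteriorAlgebra ℂ E} (hx : x ∈ ⋀[ℂ]^2 E) : p x := by
  rw [exteriorPower, pow_two] at hx
  refine Submodule.mul_induction_on hx ?_ add
  rintro _ ⟨a, rfl⟩ _ ⟨b, rfl⟩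
  exact mul a b

theorem contractLeft_mul_of_mem_two (f : Module.Dual ℂ E) {w : ExteriorAlgebra ℂ E}
    (hw : w ∈ ⋀[ℂ]^2 E) (x : ExteriorAlgebra ℂ E) :
    C⟪f⟫ (w * x) = C⟪f⟫ w * x + w * C⟪f⟫ x := by
  refine mem_two_induction (p := fun w ↦ C⟪f⟫ (w * x) = C⟪f⟫ w * x + w * C⟪f⟫ x)
    (fun a b ↦ ?_) (fun y z hy hz ↦ ?_) hw
  · rw [mul_assoc, contractLeft_ι_mul, contractLeft_ι_mul, contractLeft_ι_mul,
      CliffordAlgebra.contractLeft_ι, ← Algebra.commutes, ← Algebra.smul_def, mul_sub,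
      mul_smul_comm, sub_mul, smul_mul_assoc, smul_mul_assoc, mul_assoc]
    abel
  · rw [add_mul, map_add, map_add, hy, hz]
    noncomm_ring

theorem mul_ι_of_mem_two (e : E) {w : ExteriorAlgebra ℂ E} (hw : w ∈ ⋀[ℂ]^2 E) :
    w * ι ℂ e = ι ℂ e * w := by
  refine mem_two_induction (p := fun w ↦ w * ι ℂ e = ι ℂ e * w)
    (fun a b ↦ ?_) (fun y z hy hz ↦ ?_) hw
  · rw [mul_assoc, eq_neg_of_add_eq_zero_left (ι_add_mul_swap b e), mul_neg, ← mul_assoc,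
      eq_neg_of_add_eq_zero_left (ι_add_mul_swap a e), neg_mul, neg_neg, mul_assoc]
  · rw [add_mul, mul_add, hy, hz]

theorem mul_mem_add {m n : ℕ} {x y : ExteriorAlgebra ℂ E} (hx : x ∈ ⋀[ℂ]^m E)
    (hy : y ∈ ⋀[ℂ]^n E) : x * y ∈ ⋀[ℂ]^(m + n) E := by
  rw [exteriorPower, pow_add]
  exact Submodule.mul_mem_mul hx hy

section Dimension

variable [FiniteDimensional ℂ E]

theorem eq_zero_of_mem_six (hE : finrank ℂ E = 5) {x : ExteriorAlgebra ℂ E}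
    (hx : x ∈ ⋀[ℂ]^6 E) : x = 0 := by
  have h : finrank ℂ (⋀[ℂ]^6 E) = 0 := by rw [exteriorPower.finrank_eq, hE]; rfl
  rw [Submodule.finrank_eq_zero.1 h] at hx
  simpa using hx

theorem exists_contractLeft_eq_zero (hE : finrank ℂ E = 5) {η : ExteriorAlgebra ℂ E}
    (hη : η ∈ ⋀[ℂ]^4 E) : ∃ f : Module.Dual ℂ E, f ≠ 0 ∧ C⟪f⟫ η = 0 := by
  have : Nontrivial E := Module.nontrivial_of_finrank_pos (R := ℂ) (by omega)
  have h5 : finrank ℂ (⋀[ℂ]^5 E) = 1 := by rw [exteriorPower.finrank_eq, hE]; rfl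
  have h4 : finrank ℂ (⋀[ℂ]^4 E) = 5 := by rw [exteriorPower.finrank_eq, hE]; rfl
  have : Nontrivial (⋀[ℂ]^5 E) := Module.nontrivial_of_finrank_pos (R := ℂ) (by omega)
  obtain ⟨⟨vol, hvol⟩, hne⟩ := exists_ne (0 : ⋀[ℂ]^5 E)
  let T : Module.Dual ℂ E →ₗ[ℂ] ⋀[ℂ]^4 E :=
    ((CliffordAlgebra.contractLeft (Q := (0 : QuadraticForm ℂ E))).flip vol).codRestrict _
      fun f ↦ contractLeft_mem f hvol
  have hT (f) : (T f : ExteriorAlgebra ℂ E) = C⟪f⟫ vol := rfl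
  have hinj : Function.Injective T := by
    refine (injective_iff_map_eq_zero _).2 fun f hf ↦ LinearMap.ext fun e ↦ ?_
    have h1 : C⟪f⟫ vol = 0 := by rw [← hT, hf]; rfl
    have h2 := contractLeft_ι_mul f e vol
    rw [h1, mul_zero, sub_zero, eq_zero_of_mem_six hE (ι_mul_mem e hvol), map_zero] at h2
    exact (smul_eq_zero.1 h2.symm).resolve_right fun h ↦ hne (Subtype.ext h)
  have hsurj : Function.Surjective T :=
    (LinearMap.injective_iff_surjective_of_finrank_eq_finrank
      (by rw [Subspace.dual_finrank_eq, hE, h4])).1 hinj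
  obtain ⟨g, hg⟩ := hsurj ⟨η, hη⟩
  have hg' : C⟪g⟫ vol = η := by rw [← hT, hg]
  by_cases h : g = 0
  · obtain ⟨f, hf⟩ := exists_ne (0 : Module.Dual ℂ E)
    exact ⟨f, hf, by rw [← hg', h, map_zero, LinearMap.zero_apply, map_zero]⟩
  · exact ⟨g, h, by rw [← hg', CliffordAlgebra.contractLeft_contractLeft]⟩

theorem exists_cliff_eq_zero (hE : finrank ℂ E = 5) {a : ℂ} (ha : a ≠ 0)
    {w η : ExteriorAlgebra ℂ E} (hw : w ∈ ⋀[ℂ]^2 E) (hη : η ∈ ⋀[ℂ]^4 E) :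
    ∃ p : E × Module.Dual ℂ E, p ≠ 0 ∧ cliff p (algebraMap ℂ _ a + w + η) = 0 := by
  obtain ⟨f, hf, hfη⟩ := exists_contractLeft_eq_zero hE
    (η := a • η - (2⁻¹ : ℂ) • (w * w))
    (Submodule.sub_mem _ (Submodule.smul_mem _ _ hη) (Submodule.smul_mem _ _ (mul_mem_add hw hw)))
  have h1 : C⟪f⟫ w ∈ ⋀[ℂ]^1 E := contractLeft_mem f hw
  rw [exteriorPower, pow_one] at h1
  obtain ⟨e, he⟩ := h1
  have hcomm := mul_ι_of_mem_two e hw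
  have hfη' : a • C⟪f⟫ η = ι ℂ e * w := by
    rw [map_sub, map_smul, map_smul, contractLeft_mul_of_mem_two f hw, ← he, hcomm,
      sub_eq_zero] at hfη
    rw [hfη]; module
  have hw3 : ι ℂ e * (w * w) = 0 := by
    have h := contractLeft_mul_of_mem_two f hw (w * w)
    rw [eq_zero_of_mem_six hE (mul_mem_add hw (mul_mem_add hw hw)), map_zero,
      contractLeft_mul_of_mem_two f hw, ← he, hcomm, mul_add, ← mul_assoc w, hcomm, mul_assoc] at h
    have h' : (3 : ℂ) • (ι ℂ e * (w * w)) = 0 := by rw [h]; module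
    simpa using h'
  have hwη : a • (ι ℂ e * η) = 0 := by
    have h := contractLeft_mul_of_mem_two f hw η
    rw [eq_zero_of_mem_six hE (mul_mem_add hw hη), map_zero, ← he] at h
    rw [eq_neg_of_add_eq_zero_left h.symm, smul_neg, ← mul_smul_comm, hfη', ← mul_assoc, hcomm,
      mul_assoc, hw3, neg_zero]
  refine ⟨(-e, a • f), fun h ↦ ?_, ?_⟩
  · simp [ha, hf] at h
  · have hη0 : ι ℂ e * η = 0 := (smul_eq_zero.1 hwη).resolve_left ha
    simp only [cliff_apply, map_neg, map_smul, LinearMap.smul_apply, map_add,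
      CliffordAlgebra.contractLeft_algebraMap, neg_mul, hη0, ← he, hfη',
      ← Algebra.commutes a (ι ℂ e), ← Algebra.smul_def]
    simp

end Dimension

theorem mem_deltaPlus_iff {x : ExteriorAlgebra ℂ E} : x ∈ deltaPlus E ↔
    ∃ a : ℂ, ∃ w ∈ ⋀[ℂ]^2 E, ∃ η ∈ ⋀[ℂ]^4 E, x = algebraMap ℂ _ a + w + η := by
  simp only [deltaPlus, Submodule.mem_sup]
  constructor
  · rintro ⟨_, ⟨u, hu, w, hw, rfl⟩, η, hη, rfl⟩
    rw [exteriorPower, pow_zero, Submodule.mem_one] at hu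
    obtain ⟨a, rfl⟩ := hu
    exact ⟨a, w, hw, η, hη, rfl⟩
  · rintro ⟨a, w, hw, η, hη, rfl⟩
    refine ⟨_, ⟨_, ?_, w, hw, rfl⟩, η, hη, rfl⟩
    rw [exteriorPower, pow_zero, Submodule.mem_one]
    exact ⟨a, rfl⟩

theorem cliff_mem_deltaMinus (p : E × Module.Dual ℂ E) {x : ExteriorAlgebra ℂ E}
    (hx : x ∈ deltaPlus E) : cliff p x ∈ deltaMinus E := by
  have h1 : ⋀[ℂ]^1 E ≤ deltaMinus E := le_sup_left.trans le_sup_left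
  have h3 : ⋀[ℂ]^3 E ≤ deltaMinus E := le_sup_right.trans le_sup_left
  have h5 : ⋀[ℂ]^5 E ≤ deltaMinus E := le_sup_right
  have h : deltaPlus E ≤ (deltaMinus E).comap (cliff p) := by
    refine sup_le (sup_le ?_ ?_) ?_ <;> intro y hy <;>
      rw [Submodule.mem_comap, cliff_apply] <;> refine Submodule.add_mem _ ?_ ?_
    · exact h1 (ι_mul_mem _ hy)
    · rw [contractLeft_eq_zero_of_mem_zero _ hy]; exact Submodule.zero_mem _
    · exact h3 (ι_mul_mem _ hy)
    · exact h1 (contractLeft_mem _ hy)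
    · exact h5 (ι_mul_mem _ hy)
    · exact h3 (contractLeft_mem _ hy)
  exact h hx

theorem cliff_mem_deltaPlus [FiniteDimensional ℂ E] (hE : finrank ℂ E = 5)
    (p : E × Module.Dual ℂ E) {x : ExteriorAlgebra ℂ E}
    (hx : x ∈ deltaMinus E) : cliff p x ∈ deltaPlus E := by
  have h0 : ⋀[ℂ]^0 E ≤ deltaPlus E := le_sup_left.trans le_sup_left
  have h2 : ⋀[ℂ]^2 E ≤ deltaPlus E := le_sup_right.trans le_sup_left
  have h4 : ⋀[ℂ]^4 E ≤ deltaPlus E := le_sup_right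
  have h : deltaMinus E ≤ (deltaPlus E).comap (cliff p) := by
    refine sup_le (sup_le ?_ ?_) ?_ <;> intro y hy <;>
      rw [Submodule.mem_comap, cliff_apply] <;> refine Submodule.add_mem _ ?_ ?_
    · exact h2 (ι_mul_mem _ hy)
    · exact h0 (contractLeft_mem _ hy)
    · exact h4 (ι_mul_mem _ hy)
    · exact h2 (contractLeft_mem _ hy)
    · rw [eq_zero_of_mem_six hE (ι_mul_mem _ hy)]; exact Submodule.zero_mem _
    · exact h4 (contractLeft_mem _ hy)
  exact h hx

theorem finrank_deltaPlus [FiniteDimensional ℂ E] (hE : finrank ℂ E = 5) :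
    finrank ℂ (deltaPlus E) = 16 := by
  have hind : iSupIndep fun i : ℕ ↦ ⋀[ℂ]^i E :=
    (DirectSum.Decomposition.isInternal fun i : ℕ ↦ ⋀[ℂ]^i E).submodule_iSupIndep
  have h02 : Disjoint (⋀[ℂ]^0 E) (⋀[ℂ]^2 E) := hind.pairwiseDisjoint (by decide)
  have h4 : Disjoint (⋀[ℂ]^0 E ⊔ ⋀[ℂ]^2 E) (⋀[ℂ]^4 E) := by
    refine ((hind 4).mono_right ?_).symm
    exact sup_le (le_iSup₂_of_le 0 (by decide) le_rfl) (le_iSup₂_of_le 2 (by decide) le_rfl)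
  have e1 := Submodule.finrank_sup_add_finrank_inf_eq (⋀[ℂ]^0 E) (⋀[ℂ]^2 E)
  have e2 := Submodule.finrank_sup_add_finrank_inf_eq (⋀[ℂ]^0 E ⊔ ⋀[ℂ]^2 E) (⋀[ℂ]^4 E)
  rw [h02.eq_bot, finrank_bot, exteriorPower.finrank_eq, exteriorPower.finrank_eq, hE] at e1
  rw [h4.eq_bot, finrank_bot, exteriorPower.finrank_eq, hE] at e2
  norm_num [Nat.choose] at e1 e2
  rw [deltaPlus, e2, e1]

instance [FiniteDimensional ℂ E] : FiniteDimensional ℂ (deltaPlus E) := by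
  unfold deltaPlus; infer_instance

/-- The linear map `δ ↦ ψ_δ`. -/
noncomputable def psi (E : Type*) [AddCommGroup E] [Module ℂ E] :
    deltaPlus E →ₗ[ℂ] (E × Module.Dual ℂ E) →ₗ[ℂ] deltaMinus E where
  toFun δ := (cliff.flip (δ : ExteriorAlgebra ℂ E)).codRestrict _
    fun p ↦ cliff_mem_deltaMinus p δ.2
  map_add' _ _ := LinearMap.ext fun p ↦ Subtype.ext (map_add (cliff p) _ _)
  map_smul' c _ := LinearMap.ext fun p ↦ Subtype.ext (map_smul (cliff p) c _)

theorem coe_psi (δ : deltaPlus E) (p : E × Module.Dual ℂ E) :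
    (psi E δ p : ExteriorAlgebra ℂ E) = cliff p δ := rfl

theorem span_psiSet : Submodule.span ℂ (psiSet E) = LinearMap.range (psi E) := by
  have h : psiSet E = LinearMap.range (psi E) := by
    ext g
    constructor
    · rintro ⟨δ, hδ, h⟩
      exact ⟨⟨δ, hδ⟩, LinearMap.ext fun p ↦ Subtype.ext (h p).symm⟩
    · rintro ⟨δ, rfl⟩
      exact ⟨δ, δ.2, fun p ↦ rfl⟩
  rw [h, Submodule.span_eq]

theorem eq_zero_of_forall_cliff_eq_zero [Nontrivial E] {x : ExteriorAlgebra ℂ E}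
    (hx : ∀ p, cliff p x = 0) : x = 0 := by
  obtain ⟨e, he⟩ := exists_ne (0 : E)
  obtain ⟨f, hf⟩ := Module.Projective.exists_dual_eq_one ℂ he
  have h := cliff_cliff (0, f) (e, 0) x
  simpa [hx, hf] using h.symm

theorem psi_injective [Nontrivial E] : Function.Injective (psi E) := by
  refine (injective_iff_map_eq_zero _).2 fun δ hδ ↦ Subtype.ext ?_
  refine eq_zero_of_forall_cliff_eq_zero fun p ↦ ?_
  rw [← coe_psi, hδ]
  rfl

theorem finrank_prod_dual [FiniteDimensional ℂ E] (hE : finrank ℂ E = 5) :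
    finrank ℂ (E × Module.Dual ℂ E) = 10 := by
  rw [finrank_prod, Subspace.dual_finrank_eq, hE]

theorem not_injective_iff_finrank_range_le [FiniteDimensional ℂ E] (hE : finrank ℂ E = 5)
    {W : Type*} [AddCommGroup W] [Module ℂ W] (g : (E × Module.Dual ℂ E) →ₗ[ℂ] W) :
    ¬ Function.Injective g ↔ finrank ℂ (LinearMap.range g) ≤ 9 := by
  have h := LinearMap.finrank_range_add_finrank_ker g
  rw [finrank_prod_dual hE] at h
  rw [← LinearMap.ker_eq_bot, ← Submodule.finrank_eq_zero]
  omega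

theorem not_injective_psi [FiniteDimensional ℂ E] (hE : finrank ℂ E = 5) (δ : deltaPlus E) :
    ¬ Function.Injective (psi E δ) := by
  have key (a : ℂ) (ha : a ≠ 0) (w η : ExteriorAlgebra ℂ E) (hw : w ∈ ⋀[ℂ]^2 E)
      (hη : η ∈ ⋀[ℂ]^4 E) (δ : deltaPlus E)
      (hδ : (δ : ExteriorAlgebra ℂ E) = algebraMap ℂ _ a + w + η) :
      ¬ Function.Injective (psi E δ) := by
    intro hinj
    obtain ⟨p, hp, hp0⟩ := exists_cliff_eq_zero hE ha hw hη
    refine hp ((injective_iff_map_eq_zero _).1 hinj p (Subtype.ext ?_))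
    rw [coe_psi, hδ, hp0]
    rfl
  obtain ⟨a, w, hw, η, hη, h⟩ := mem_deltaPlus_iff.1 δ.2
  by_cases ha : a = 0
  · intro hinj
    obtain ⟨t, ht, h'⟩ := LinearMap.exists_ne_zero_injective_add_smul hinj
      (psi E ⟨algebraMap ℂ _ 1, mem_deltaPlus_iff.2 ⟨1, 0, zero_mem _, 0, zero_mem _, by simp⟩⟩)
    rw [← map_smul, ← map_add] at h'
    refine key t ht w η hw hη _ ?_ h'
    simp [h, ha, Algebra.smul_def]
    abel
  · exact key a ha w η hw hη δ h

section Basis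

variable (b : Basis (Fin 5) ℂ E)

/-- The spinor `1 + b₀ ∧ b₁ + s • b₀ ∧ b₂ ∧ b₃ ∧ b₄`; for `s ≠ 0` it is annihilated only by the
line spanned by the null vector `(b₀, b₁*)`. -/
noncomputable def spinor (s : ℂ) : ExteriorAlgebra ℂ E :=
  1 + ι ℂ (b 0) * ι ℂ (b 1) + s • (ι ℂ (b 0) * (ι ℂ (b 2) * (ι ℂ (b 3) * ι ℂ (b 4))))

theorem spinor_mem_deltaPlus (s : ℂ) : spinor b s ∈ deltaPlus E := by
  have h1 (i) : ι ℂ (b i) ∈ ⋀[ℂ]^1 E := by rw [exteriorPower, pow_one]; exact ⟨_, rfl⟩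
  exact mem_deltaPlus_iff.2 ⟨1, _, ι_mul_mem (b 0) (h1 1), _,
    Submodule.smul_mem _ s (ι_mul_mem (b 0) (ι_mul_mem (b 2) (ι_mul_mem (b 3) (h1 4)))),
    by simp [spinor]⟩

theorem cliff_spinor (s : ℂ) : cliff (b 0, b.coord 1) (spinor b s) = 0 := by
  simp [cliff_apply, spinor, mul_add, ι_mul_ι_mul_self, contractLeft_ι_mul,
    CliffordAlgebra.contractLeft_ι, CliffordAlgebra.contractLeft_one]

theorem eq_smul_of_cliff_spinor_eq_zero {s : ℂ} (hs : s ≠ 0) {p : E × Module.Dual ℂ E}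
    (hp : cliff p (spinor b s) = 0) : p = p.2 (b 1) • (b 0, b.coord 1) := by
  have h1 (g : Module.Dual ℂ E) := congrArg (fun x ↦ algebraMapInv (C⟪g⟫ x)) hp
  have h3 (i j k : Fin 5) := congrArg
    (fun x ↦ algebraMapInv (C⟪b.coord i⟫ (C⟪b.coord j⟫ (C⟪b.coord k⟫ x)))) hp
  simp [cliff_apply, spinor, mul_add, contractLeft_ι_mul,
    CliffordAlgebra.contractLeft_ι, CliffordAlgebra.contractLeft_one, algebraMapInv_ι] at h1 h3
  have hp2 := h3 0 3 4
  have hp0 := h3 2 3 4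
  have hp3 := h3 0 2 4
  have hp4 := h3 0 2 3
  simp [hs] at hp0 hp2 hp3 hp4
  refine Prod.ext ?_ (b.ext fun i ↦ ?_)
  · rw [← sub_eq_zero, ← Module.forall_dual_apply_eq_zero_iff ℂ]
    intro g
    simpa [hp0, mul_comm, sub_eq_add_neg] using h1 g
  · fin_cases i <;> simp [hp0, hp2, hp3, hp4]

theorem ker_psi_spinor {s : ℂ} (hs : s ≠ 0) :
    LinearMap.ker (psi E ⟨spinor b s, spinor_mem_deltaPlus b s⟩) = ℂ ∙ (b 0, b.coord 1) := by
  refine le_antisymm (fun p hp ↦ ?_) ?_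
  · exact Submodule.mem_span_singleton.2
      ⟨_, (eq_smul_of_cliff_spinor_eq_zero b hs (congrArg Subtype.val hp)).symm⟩
  · rw [Submodule.span_singleton_le_iff_mem]
    exact Subtype.ext (cliff_spinor b s)

theorem eq_zero_of_eq_smul_spinor {c d : ℂ} (h : c • spinor b 1 = d • spinor b 2) : c = 0 := by
  have h0 := congrArg algebraMapInv h
  have h4 := congrArg (fun x ↦ algebraMapInv (C⟪b.coord 4⟫ (C⟪b.coord 3⟫
    (C⟪b.coord 2⟫ (C⟪b.coord 0⟫ x))))) h
  simp [spinor, contractLeft_ι_mul,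
    CliffordAlgebra.contractLeft_ι, CliffordAlgebra.contractLeft_one, algebraMapInv_ι] at h0 h4
  linear_combination 2 * h0 - h4

end Basis

section Critical

variable [FiniteDimensional ℂ E]

theorem cliff_apply_eq_zero_of_pairing_eq_zero (hE : finrank ℂ E = 5)
    {B : (E × Module.Dual ℂ E) →ₗ[ℂ] deltaMinus E}
    (hB : ∀ (δ) (t : ℂ), ¬ Function.Injective (psi E δ + t • B)) {e : E} {f : Module.Dual ℂ E}
    (he : e ≠ 0) (hf : f ≠ 0) (hef : f e = 0) : cliff (e, f) (B (e, f)) = 0 := by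
  obtain ⟨b, rfl, rfl⟩ := Basis.exists_fin_of_pairing_eq_zero hE hef he hf
  have key (s : ℂ) (hs : s ≠ 0) : ∃ c : ℂ,
      cliff (b 0, b.coord 1) (B (b 0, b.coord 1)) = c • spinor b s := by
    obtain ⟨u, hu⟩ := LinearMap.apply_mem_range_of_forall_not_injective
      (v := (b 0, b.coord 1)) (fun h ↦ he (congrArg Prod.fst h)) (ker_psi_spinor b hs) (hB _)
    rw [← hu, coe_psi, cliff_cliff, cliff_spinor]
    exact ⟨_, by rw [map_zero (cliff u), sub_zero]⟩
  obtain ⟨c, hc⟩ := key 1 one_ne_zero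
  obtain ⟨d, hd⟩ := key 2 two_ne_zero
  rw [hc, eq_zero_of_eq_smul_spinor b (hc.symm.trans hd), zero_smul]

theorem exists_ne_zero_dual_apply_eq_zero (hE : finrank ℂ E = 5) (e : E) :
    ∃ f : Module.Dual ℂ E, f ≠ 0 ∧ f e = 0 := by
  have h : LinearMap.ker (Module.Dual.eval ℂ E e) ≠ ⊥ := by
    refine LinearMap.ker_ne_bot_of_finrank_lt ?_
    rw [Subspace.dual_finrank_eq, hE, finrank_self]
    decide
  obtain ⟨f, hf, hf0⟩ := Submodule.exists_mem_ne_zero_of_ne_bot h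
  exact ⟨f, hf0, hf⟩

theorem exists_ne_zero_apply_eq_zero (hE : finrank ℂ E = 5) (f : Module.Dual ℂ E) :
    ∃ e : E, e ≠ 0 ∧ f e = 0 := by
  have h : LinearMap.ker f ≠ ⊥ := by
    refine LinearMap.ker_ne_bot_of_finrank_lt ?_
    rw [hE, finrank_self]
    decide
  obtain ⟨e, he, he0⟩ := Submodule.exists_mem_ne_zero_of_ne_bot h
  exact ⟨e, he0, he⟩

theorem mem_range_psi_of_forall_not_injective (hE : finrank ℂ E = 5)
    {B : (E × Module.Dual ℂ E) →ₗ[ℂ] deltaMinus E}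
    (hB : ∀ (δ) (t : ℂ), ¬ Function.Injective (psi E δ + t • B)) : B ∈ LinearMap.range (psi E) := by
  have : Nontrivial E := Module.nontrivial_of_finrank_pos (R := ℂ) (by omega)
  let β : (E × Module.Dual ℂ E) →ₗ[ℂ] ExteriorAlgebra ℂ E := (deltaMinus E).subtype ∘ₗ B
  have hβ (e : E) (f : Module.Dual ℂ E) (he : e ≠ 0) (hf : f ≠ 0) (hef : f e = 0) :
      ι ℂ e * β (e, 0) = 0 ∧ C⟪f⟫ (β (0, f)) = 0 ∧ ι ℂ e * β (0, f) + C⟪f⟫ (β (e, 0)) = 0 := by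
    have key (t : ℂ) (ht : t ≠ 0) : ι ℂ e * β (e, 0) + t ^ 2 • C⟪f⟫ (β (0, f)) +
        t • (ι ℂ e * β (0, f) + C⟪f⟫ (β (e, 0))) = 0 := by
      have h : cliff (e, t • f) (β (e, t • f)) = 0 :=
        cliff_apply_eq_zero_of_pairing_eq_zero hE hB he (smul_ne_zero ht hf) (by simp [hef])
      have h' : β (e, t • f) = β (e, 0) + t • β (0, f) := by
        rw [← map_smul, ← map_add]; simp
      rw [h', cliff_apply] at h
      simp only [mul_add, map_add, map_smul, LinearMap.smul_apply, mul_smul_comm] at h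
      rw [← h]
      module
    have k1 := key 1 one_ne_zero
    have k2 := key (-1) (by simp)
    have k3 := key 2 two_ne_zero
    refine ⟨?_, ?_, ?_⟩
    · linear_combination (norm := module) k1 + (3⁻¹ : ℂ) • k2 - (3⁻¹ : ℂ) • k3
    · linear_combination (norm := module) (-2⁻¹ : ℂ) • k1 + (6⁻¹ : ℂ) • k2 + (3⁻¹ : ℂ) • k3
    · linear_combination (norm := module) (2⁻¹ : ℂ) • k1 - (2⁻¹ : ℂ) • k2
  have hee (e : E) : ι ℂ e * β (e, 0) = 0 := by
    by_cases he : e = 0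
    · simp [he]
    · obtain ⟨f, hf, hef⟩ := exists_ne_zero_dual_apply_eq_zero hE e
      exact (hβ e f he hf hef).1
  have hff (f : Module.Dual ℂ E) : C⟪f⟫ (β (0, f)) = 0 := by
    by_cases hf : f = 0
    · simp [hf]
    · obtain ⟨e, he, hef⟩ := exists_ne_zero_apply_eq_zero hE f
      exact (hβ e f he hf hef).2.1
  let Φ : E →ₗ[ℂ] Module.Dual ℂ E →ₗ[ℂ] ExteriorAlgebra ℂ E :=
    (LinearMap.mul ℂ (ExteriorAlgebra ℂ E) ∘ₗ ι ℂ).compl₂ (β ∘ₗ LinearMap.inr ℂ _ _) +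
      ((CliffordAlgebra.contractLeft (Q := (0 : QuadraticForm ℂ E))).compl₂
        (β ∘ₗ LinearMap.inl ℂ _ _)).flip
  obtain ⟨δ, hδ⟩ := LinearMap.eq_apply_smul_of_forall_apply_eq_zero Φ fun e f hef ↦ by
    by_cases he : e = 0
    · simp [he]
    by_cases hf : f = 0
    · simp [hf]
    exact (hβ e f he hf hef).2.2
  replace hδ (e f) : ι ℂ e * β (0, f) + C⟪f⟫ (β (e, 0)) = f e • δ := hδ e f
  have hδmem : δ ∈ deltaPlus E := by
    obtain ⟨e, he⟩ := exists_ne (0 : E)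
    obtain ⟨f, hf⟩ := Module.Projective.exists_dual_eq_one ℂ he
    rw [← one_smul ℂ δ, ← hf, ← hδ]
    have h1 := cliff_mem_deltaPlus hE (e, 0) (B (0, f)).2
    have h2 := cliff_mem_deltaPlus hE (0, f) (B (e, 0)).2
    simp only [cliff_apply, map_zero, LinearMap.zero_apply, zero_mul, add_zero, zero_add] at h1 h2
    exact Submodule.add_mem _ h1 h2
  have hBe (e : E) : β (e, 0) = ι ℂ e * δ := by
    by_cases he : e = 0
    · rw [he, map_zero, zero_mul]; exact map_zero β
    obtain ⟨f, hf⟩ := Module.Projective.exists_dual_eq_one ℂ he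
    have h1 := contractLeft_ι_mul f e (β (e, 0))
    have h2 := congrArg (ι ℂ e * ·) (hδ e f)
    simp only [hee, map_zero, hf, one_smul, mul_add, ι_mul_ι_mul_self,
      zero_add] at h1 h2
    exact (sub_eq_zero.1 h1.symm).trans h2
  have hBf (f : Module.Dual ℂ E) : β (0, f) = C⟪f⟫ δ := by
    by_cases hf0 : f = 0
    · rw [hf0, map_zero]; exact map_zero β
    obtain ⟨e, he⟩ : ∃ e, f e = 1 := LinearMap.surjective hf0 1
    have h1 := contractLeft_ι_mul f e (β (0, f))
    have h2 := congrArg C⟪f⟫ (hδ e f)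
    simp only [hff, mul_zero, sub_zero, he, one_smul, map_add,
      CliffordAlgebra.contractLeft_contractLeft, add_zero] at h1 h2
    rw [← h2, h1]
  refine ⟨⟨δ, hδmem⟩, LinearMap.ext fun ⟨e, f⟩ ↦ Subtype.ext ?_⟩
  rw [coe_psi, cliff_apply, ← hBe, ← hBf, ← map_add]
  simp [β]

end Critical

end ExteriorAlgebra

/-- For `dim E = 5`, the space `L = {ψ_δ : δ ∈ Δ₊} ⊆ Hom(E ⊕ E*, Δ₋)` is a `16`-dimensional
linear space of linear maps (the assignment `δ ↦ ψ_δ` being injective), its maximal rank is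
`9`, and it is rank-critical: every linear subspace of `Hom(E ⊕ E*, Δ₋)` strictly containing
`L` contains an element of rank strictly greater than `9`. -/
theorem psi_space_rank_critical
    [FiniteDimensional ℂ E] (hE : finrank ℂ E = 5) :
    (∀ δ ∈ deltaPlus E, ∀ δ' ∈ deltaPlus E,
        (∀ p : E × Module.Dual ℂ E,
          ι ℂ p.1 * δ + CliffordAlgebra.contractLeft (Q := (0 : QuadraticForm ℂ E)) p.2 δ =
            ι ℂ p.1 * δ' +
              CliffordAlgebra.contractLeft (Q := (0 : QuadraticForm ℂ E)) p.2 δ') → δ = δ') ∧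
      finrank ℂ (Submodule.span ℂ (psiSet E)) = 16 ∧
      (∀ g ∈ Submodule.span ℂ (psiSet E), finrank ℂ (LinearMap.range g) ≤ 9) ∧
      (∃ g ∈ Submodule.span ℂ (psiSet E), finrank ℂ (LinearMap.range g) = 9) ∧
      ∀ L' : Submodule ℂ ((E × Module.Dual ℂ E) →ₗ[ℂ] deltaMinus E),
        Submodule.span ℂ (psiSet E) < L' →
          ∃ B ∈ L', 9 < finrank ℂ (LinearMap.range B) := by
  have : Nontrivial E := Module.nontrivial_of_finrank_pos (R := ℂ) (by omega)
  rw [span_psiSet]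
  refine ⟨fun δ hδ δ' hδ' h ↦ ?_, ?_, ?_, ?_, fun L' hL' ↦ ?_⟩
  · exact congrArg Subtype.val (psi_injective (a₁ := ⟨δ, hδ⟩) (a₂ := ⟨δ', hδ'⟩)
      (LinearMap.ext fun p ↦ Subtype.ext (h p)))
  · rw [LinearMap.finrank_range_of_inj psi_injective, finrank_deltaPlus hE]
  · rintro _ ⟨δ, rfl⟩
    exact (not_injective_iff_finrank_range_le hE _).1 (not_injective_psi hE δ)
  · let b : Basis (Fin 5) ℂ E := finBasisOfFinrankEq ℂ E hE
    refine ⟨_, ⟨⟨spinor b 1, spinor_mem_deltaPlus b 1⟩, rfl⟩, ?_⟩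
    have h := LinearMap.finrank_range_add_finrank_ker
      (psi E ⟨spinor b 1, spinor_mem_deltaPlus b 1⟩)
    rw [ker_psi_spinor b one_ne_zero, finrank_span_singleton (by simp [b.ne_zero]),
      finrank_prod_dual hE] at h
    omega
  · by_contra! hcon
    obtain ⟨B, hBL, hB⟩ := SetLike.exists_of_lt hL'
    refine hB (mem_range_psi_of_forall_not_injective hE fun δ t ↦ ?_)
    exact (not_injective_iff_finrank_range_le hE _).2
      (hcon _ (L'.add_mem (hL'.le ⟨δ, rfl⟩) (L'.smul_mem t hBL)))
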